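/- For every r ∈ [0,1), liminf_{n→∞} (1/n)·‖D‖_{K_{b_r^n}→H²} ≥ (1+r)/(1-r), where ‖D‖_{K_{b_r^n}→H²} is the norm of the differentiation operator on the model space of the Blaschke product b_r^n. -/

import Mathlib

open Complex Filter Finset MeasureTheory Metric

noncomputable section

/-- The `k`-th Taylor coefficient of `f` at `0`. -/
def hcoeff (f : ℂ → ℂ) (k : ℕ) : ℂ := iteratedDeriv k f 0 / (Nat.factorial k : ℂ)

/-- The Hardy space `H²` norm of `f`, computed through the Taylor coefficients at `0`:
`‖f‖₂² = ∑_{k≥0} |f̂(k)|²`. -/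
def h2norm (f : ℂ → ℂ) : ℝ := Real.sqrt (∑' k : ℕ, ‖hcoeff f k‖ ^ 2)

/-- Membership in the Hardy space `H²` of the unit disc: `f` is holomorphic on the unit
disc and its Taylor coefficients are square-summable. -/
def MemH2 (f : ℂ → ℂ) : Prop :=
  DifferentiableOn ℂ f (ball 0 1) ∧ Summable (fun k : ℕ => ‖hcoeff f k‖ ^ 2)

/-- The `H²` inner product `(f,g) = ∑_{k≥0} f̂(k)·conj(ĝ(k))`. -/
def h2inner (f g : ℂ → ℂ) : ℂ := ∑' k : ℕ, hcoeff f k * (starRingEnd ℂ) (hcoeff g k)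

/-- Elementary Blaschke factor `b_λ(z) = (λ - z)/(1 - conj(λ)·z)`. -/
def blaschke (l : ℂ) : ℂ → ℂ := fun z => (l - z) / (1 - (starRingEnd ℂ) l * z)

/-- Membership in the model space `K_B = H² ⊖ B·H²`: `f ∈ H²` and `f` is orthogonal to
`B·g` for every `g ∈ H²`. -/
def MemKB (B f : ℂ → ℂ) : Prop :=
  MemH2 f ∧ ∀ g : ℂ → ℂ, MemH2 g → h2inner f (fun z => B z * g z) = 0

/-- The norm of the differentiation operator `D : K_B → H²`, `Df = f'`. -/
def DNorm (B : ℂ → ℂ) : ℝ :=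
  sSup {x : ℝ | ∃ f : ℂ → ℂ, MemKB B f ∧ h2norm f ≤ 1 ∧ x = h2norm (deriv f)}

/-- `C_{n,r}`: the supremum of `‖D‖_{K_{B_σ} → H²}` over all finite sequences `σ` in the
unit disc with `1 ≤ card σ ≤ n` and `|λ| ≤ r` for all `λ ∈ σ`. -/
def Cnr (n : ℕ) (r : ℝ) : ℝ :=
  sSup {x : ℝ | ∃ m : ℕ, 1 ≤ m ∧ m ≤ n ∧ ∃ l : Fin m → ℂ,
    (∀ j, ‖l j‖ ≤ r) ∧ x = DNorm (fun z => ∏ j, blaschke (l j) z)}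

/-- The Malmquist–Walsh basis function `e_k(z) = (1-r²)^{1/2}/(1-rz) · b_r(z)^{k-1}`
of the model space `K_{b_r^n}`. -/
def mw (r : ℝ) (k : ℕ) : ℂ → ℂ :=
  fun z => (Real.sqrt (1 - r ^ 2) : ℂ) / (1 - (r : ℂ) * z) * (blaschke (r : ℂ) z) ^ (k - 1)

/-- The Hilbert space `ℓ²(ℕ)` of Taylor coefficients. -/
abbrev EllTwo : Type := lp (fun _ : ℕ => ℂ) 2

namespace EllTwo

theorem memℓp_two_iff (x : ℕ → ℂ) : Memℓp (E := fun _ : ℕ => ℂ) x 2 ↔ Summable fun k => ‖x k‖ ^ 2 := by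
  rw [memℓp_gen_iff (by norm_num)]
  simp

/-- The element of `ℓ²` with a given square-summable sequence of coordinates. -/
def mk (x : ℕ → ℂ) (hx : Summable fun k => ‖x k‖ ^ 2) : EllTwo := ⟨x, (memℓp_two_iff x).2 hx⟩

@[simp] theorem mk_apply (x : ℕ → ℂ) (hx) (k : ℕ) : mk x hx k = x k := rfl

theorem summable_norm_sq (x : EllTwo) : Summable fun k => ‖x k‖ ^ 2 := (memℓp_two_iff x).1 x.2

theorem norm_sq_eq (x : EllTwo) : ‖x‖ ^ 2 = ∑' k, ‖x k‖ ^ 2 := by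
  have := lp.norm_rpow_eq_tsum (p := 2) (by norm_num) x
  simpa using this

theorem inner_eq (x y : EllTwo) : inner ℂ x y = ∑' k, y k * (starRingEnd ℂ) (x k) := by
  rw [lp.inner_eq_tsum]
  rfl

theorem norm_apply_le (x : EllTwo) (k : ℕ) : ‖x k‖ ≤ ‖x‖ := lp.norm_apply_le_norm (by norm_num) x k

/-- The holomorphic function on the disc with a given sequence of Taylor coefficients. -/
def toFun (x : EllTwo) (z : ℂ) : ℂ := ∑' k, x k * z ^ k

theorem summable_mul_pow (x : EllTwo) {z : ℂ} (hz : z ∈ ball (0 : ℂ) 1) :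
    Summable fun k => x k * z ^ k := by
  rw [mem_ball_zero_iff] at hz
  refine Summable.of_norm_bounded ((summable_geometric_of_lt_one (norm_nonneg z) hz).mul_left ‖x‖) ?_
  intro k
  rw [norm_mul, norm_pow]
  gcongr
  exact norm_apply_le x k

theorem hasFPowerSeriesOnBall_toFun (x : EllTwo) :
    HasFPowerSeriesOnBall x.toFun (FormalMultilinearSeries.ofScalars ℂ (fun k => x k)) 0 1 := by
  refine ⟨?_, by norm_num, ?_⟩
  · have := FormalMultilinearSeries.le_radius_of_bound
      (FormalMultilinearSeries.ofScalars ℂ (fun k => x k)) (r := 1) ‖x‖ (fun n => by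
        simpa [FormalMultilinearSeries.ofScalars_norm] using norm_apply_le x n)
    simpa using this
  · intro y hy
    have hy' : y ∈ ball (0 : ℂ) 1 := by simpa [← Metric.eball_ofReal] using hy
    simpa [FormalMultilinearSeries.ofScalars_apply_eq, toFun, mul_comm] using
      (summable_mul_pow x hy').hasSum

theorem hcoeff_toFun (x : EllTwo) (k : ℕ) : hcoeff x.toFun k = x k := by
  have h := x.hasFPowerSeriesOnBall_toFun.factorial_smul (1 : ℂ) k
  have hk : (k.factorial : ℂ) ≠ 0 := by exact_mod_cast k.factorial_ne_zero
  rw [hcoeff, iteratedDeriv_eq_iteratedFDeriv, ← h]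
  simp [hk]

theorem differentiableOn_toFun (x : EllTwo) : DifferentiableOn ℂ x.toFun (ball 0 1) := by
  have := x.hasFPowerSeriesOnBall_toFun.differentiableOn
  simpa [← Metric.eball_ofReal] using this

theorem toFun_add (x y : EllTwo) {z : ℂ} (hz : z ∈ ball (0 : ℂ) 1) :
    (x + y).toFun z = x.toFun z + y.toFun z := by
  rw [toFun, toFun, toFun, ← (summable_mul_pow x hz).tsum_add (summable_mul_pow y hz)]
  simp [add_mul]

theorem toFun_smul (c : ℂ) (x : EllTwo) (z : ℂ) : (c • x).toFun z = c * x.toFun z := by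
  rw [toFun, toFun, ← tsum_mul_left]
  simp [mul_assoc]

theorem toFun_sub (x y : EllTwo) {z : ℂ} (hz : z ∈ ball (0 : ℂ) 1) :
    (x - y).toFun z = x.toFun z - y.toFun z := by
  rw [toFun, toFun, toFun, ← (summable_mul_pow x hz).tsum_sub (summable_mul_pow y hz)]
  simp [sub_mul]

theorem toFun_sum {ι : Type*} (s : Finset ι) (c : ι → ℂ) (x : ι → EllTwo) {z : ℂ}
    (hz : z ∈ ball (0 : ℂ) 1) : (∑ i ∈ s, c i • x i).toFun z = ∑ i ∈ s, c i * (x i).toFun z := by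
  classical
  induction s using Finset.induction_on with
  | empty => simp [toFun]
  | insert i s hi ih => rw [Finset.sum_insert hi, Finset.sum_insert hi, toFun_add _ _ hz, ih, toFun_smul]

end EllTwo

theorem hcoeff_congr {f g : ℂ → ℂ} (h : Set.EqOn f g (ball 0 1)) : hcoeff f = hcoeff g := by
  have h' : f =ᶠ[nhds 0] g := h.eventuallyEq_of_mem (ball_mem_nhds 0 one_pos)
  funext k
  rw [hcoeff, hcoeff, h'.iteratedDeriv_eq]

theorem h2norm_eq_norm {f : ℂ → ℂ} {x : EllTwo} (h : Set.EqOn f x.toFun (ball 0 1)) :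
    h2norm f = ‖x‖ := by
  rw [h2norm, hcoeff_congr h]
  simp only [EllTwo.hcoeff_toFun]
  rw [← EllTwo.norm_sq_eq, Real.sqrt_sq (norm_nonneg _)]

theorem h2inner_eq_inner {f g : ℂ → ℂ} {x y : EllTwo} (hf : Set.EqOn f x.toFun (ball 0 1))
    (hg : Set.EqOn g y.toFun (ball 0 1)) : h2inner f g = inner ℂ y x := by
  rw [h2inner, hcoeff_congr hf, hcoeff_congr hg, EllTwo.inner_eq]
  simp only [EllTwo.hcoeff_toFun]

theorem EllTwo.memH2_toFun (x : EllTwo) : MemH2 x.toFun :=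
  ⟨x.differentiableOn_toFun, by simpa only [EllTwo.hcoeff_toFun] using x.summable_norm_sq⟩

theorem MemH2.exists_eqOn {f : ℂ → ℂ} (hf : MemH2 f) :
    ∃ x : EllTwo, Set.EqOn f x.toFun (ball 0 1) := by
  refine ⟨EllTwo.mk (hcoeff f) hf.2, fun z hz => ?_⟩
  rw [← (Complex.hasSum_taylorSeries_on_ball hf.1 hz).tsum_eq]
  refine tsum_congr fun k => ?_
  simp only [EllTwo.mk_apply, hcoeff, smul_eq_mul, sub_zero]
  ring

theorem h2norm_deriv_eq_norm {f : ℂ → ℂ} {x : EllTwo}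
    (h : ∀ z ∈ ball (0 : ℂ) 1, HasDerivAt f (x.toFun z) z) : h2norm (deriv f) = ‖x‖ :=
  h2norm_eq_norm fun z hz => (h z hz).deriv

namespace EllTwo

/-- The sequence `x` moved one place to the right. -/
def shiftSeq (x : ℕ → ℂ) : ℕ → ℂ
  | 0 => 0
  | k + 1 => x k

theorem hasSum_norm_sq_shiftSeq (x : EllTwo) : HasSum (fun k => ‖shiftSeq x k‖ ^ 2) (‖x‖ ^ 2) := by
  rw [← hasSum_nat_add_iff' 1]
  simpa [shiftSeq, norm_sq_eq] using (summable_norm_sq x).hasSum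

/-- The unilateral shift on `ℓ²`. -/
def shift : EllTwo →ₗᵢ[ℂ] EllTwo where
  toFun x := mk (shiftSeq x) (hasSum_norm_sq_shiftSeq x).summable
  map_add' x y := by ext k; cases k <;> simp [shiftSeq]
  map_smul' c x := by ext k; cases k <;> simp [shiftSeq]
  norm_map' x := by
    rw [← sq_eq_sq₀ (norm_nonneg _) (norm_nonneg _), norm_sq_eq]
    exact (hasSum_norm_sq_shiftSeq x).tsum_eq

@[simp] theorem shift_apply_zero (x : EllTwo) : shift x 0 = 0 := rfl

@[simp] theorem shift_apply_succ (x : EllTwo) (k : ℕ) : shift x (k + 1) = x k := rfl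

theorem toFun_shift (x : EllTwo) {z : ℂ} (hz : z ∈ ball (0 : ℂ) 1) :
    (shift x).toFun z = z * x.toFun z := by
  rw [toFun, (summable_mul_pow (shift x) hz).tsum_eq_zero_add, toFun, ← tsum_mul_left]
  simp only [shift_apply_zero, zero_mul, zero_add, shift_apply_succ]
  exact tsum_congr fun k => by ring

theorem norm_smul_shift_lt {r : ℝ} (hr0 : 0 ≤ r) (hr1 : r < 1) :
    ‖(r : ℂ) • (shift.toContinuousLinearMap)‖ < 1 := by
  have h := shift.norm_toContinuousLinearMap_le
  rw [norm_smul, Complex.norm_real, Real.norm_of_nonneg hr0]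
  nlinarith

/-- The operator on `ℓ²` corresponding to multiplication by the Blaschke factor `b_r`. -/
def blaschkeMul (r : ℝ) (hr0 : 0 ≤ r) (hr1 : r < 1) : EllTwo →L[ℂ] EllTwo :=
  ((r : ℂ) • 1 - shift.toContinuousLinearMap) *
    ((Units.oneSub _ (norm_smul_shift_lt hr0 hr1))⁻¹ : (EllTwo →L[ℂ] EllTwo)ˣ)

section

variable {r : ℝ} (hr0 : 0 ≤ r) (hr1 : r < 1)

theorem exists_blaschkeMul_eq (x : EllTwo) :
    ∃ u : EllTwo, x = u - (r : ℂ) • shift u ∧ blaschkeMul r hr0 hr1 x = (r : ℂ) • u - shift u := by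
  set U := Units.oneSub _ (norm_smul_shift_lt hr0 hr1)
  refine ⟨(↑U⁻¹ : EllTwo →L[ℂ] EllTwo) x, ?_, rfl⟩
  have h : ((U : EllTwo →L[ℂ] EllTwo) * (↑U⁻¹ : EllTwo →L[ℂ] EllTwo)) x = x := by
    rw [U.mul_inv]; rfl
  exact h.symm

theorem blaschkeMul_sub_smul_shift (u : EllTwo) :
    blaschkeMul r hr0 hr1 (u - (r : ℂ) • shift u) = (r : ℂ) • u - shift u := by
  set U := Units.oneSub _ (norm_smul_shift_lt hr0 hr1) with hU
  have h : ((↑U⁻¹ : EllTwo →L[ℂ] EllTwo) * (U : EllTwo →L[ℂ] EllTwo)) u = u := by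
    rw [U.inv_mul]; rfl
  have h' : (↑U⁻¹ : EllTwo →L[ℂ] EllTwo) (u - (r : ℂ) • shift u) = u := h
  rw [blaschkeMul, mul_apply_eq_comp, ← hU, h']
  rfl

theorem norm_blaschkeMul (x : EllTwo) : ‖blaschkeMul r hr0 hr1 x‖ = ‖x‖ := by
  obtain ⟨u, hx, hTx⟩ := exists_blaschkeMul_eq hr0 hr1 x
  rw [hTx, hx, ← sq_eq_sq₀ (norm_nonneg _) (norm_nonneg _), @norm_sub_sq ℂ, @norm_sub_sq ℂ,
    norm_smul, norm_smul, shift.norm_map, inner_smul_left, inner_smul_right, Complex.conj_ofReal]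
  ring

theorem one_sub_mul_ne_zero (hr0 : 0 ≤ r) (hr1 : r < 1) {z : ℂ} (hz : z ∈ ball (0 : ℂ) 1) :
    1 - (r : ℂ) * z ≠ 0 := by
  rw [mem_ball_zero_iff] at hz
  intro h
  have h1 : (r : ℂ) * z = 1 := (sub_eq_zero.1 h).symm
  have h2 := congrArg norm h1
  rw [norm_mul, Complex.norm_real, Real.norm_of_nonneg hr0, norm_one] at h2
  nlinarith [norm_nonneg z]

theorem toFun_blaschkeMul (x : EllTwo) {z : ℂ} (hz : z ∈ ball (0 : ℂ) 1) :
    (blaschkeMul r hr0 hr1 x).toFun z = blaschke r z * x.toFun z := by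
  obtain ⟨u, hx, hTx⟩ := exists_blaschkeMul_eq hr0 hr1 x
  have h := one_sub_mul_ne_zero hr0 hr1 hz
  rw [hTx, hx, toFun_sub _ _ hz, toFun_sub _ _ hz, toFun_smul, toFun_smul, toFun_shift _ hz,
    blaschke, Complex.conj_ofReal]
  field_simp

theorem toFun_blaschkeMul_pow (n : ℕ) (x : EllTwo) {z : ℂ} (hz : z ∈ ball (0 : ℂ) 1) :
    ((blaschkeMul r hr0 hr1 ^ n) x).toFun z = blaschke r z ^ n * x.toFun z := by
  induction n with
  | zero => simp
  | succ n ih =>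
    rw [pow_succ', mul_apply_eq_comp, toFun_blaschkeMul hr0 hr1 _ hz, ih, pow_succ']
    ring

theorem hasSum_kernel (hr0 : 0 ≤ r) (hr1 : r < 1) :
    HasSum (fun k : ℕ => ‖(Real.sqrt (1 - r ^ 2) : ℂ) * (r : ℂ) ^ k‖ ^ 2) 1 := by
  have h2 : 0 < 1 - r ^ 2 := by nlinarith
  have h := (hasSum_geometric_of_lt_one (sq_nonneg r) (by linarith : r ^ 2 < 1)).mul_left (1 - r ^ 2)
  rw [mul_inv_cancel₀ h2.ne'] at h
  convert! h using 2 with k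
  rw [norm_mul, norm_pow, Complex.norm_real, Complex.norm_real, mul_pow, Real.norm_eq_abs, sq_abs,
    Real.sq_sqrt h2.le, Real.norm_of_nonneg hr0]
  ring

/-- The normalized reproducing kernel of `H²` at the point `r`. -/
def kernel (r : ℝ) (hr0 : 0 ≤ r) (hr1 : r < 1) : EllTwo := mk _ (hasSum_kernel hr0 hr1).summable

theorem norm_kernel : ‖kernel r hr0 hr1‖ = 1 := by
  rw [← sq_eq_sq₀ (norm_nonneg _) zero_le_one, norm_sq_eq, one_pow]
  exact (hasSum_kernel hr0 hr1).tsum_eq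

theorem kernel_apply (k : ℕ) :
    kernel r hr0 hr1 k = (Real.sqrt (1 - r ^ 2) : ℂ) * (r : ℂ) ^ k := rfl

theorem inner_kernel (x : EllTwo) :
    inner ℂ (kernel r hr0 hr1) x = (Real.sqrt (1 - r ^ 2) : ℂ) * x.toFun r := by
  rw [inner_eq, toFun, ← tsum_mul_left]
  refine tsum_congr fun k => ?_
  rw [kernel_apply, map_mul, map_pow, Complex.conj_ofReal, Complex.conj_ofReal]
  ring

theorem toFun_kernel {z : ℂ} (hz : z ∈ ball (0 : ℂ) 1) :
    (kernel r hr0 hr1).toFun z = (Real.sqrt (1 - r ^ 2) : ℂ) / (1 - (r : ℂ) * z) := by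
  have h : ‖(r : ℂ) * z‖ < 1 := by
    rw [mem_ball_zero_iff] at hz
    rw [norm_mul, Complex.norm_real, Real.norm_of_nonneg hr0]
    nlinarith [norm_nonneg z]
  rw [toFun, div_eq_mul_inv, ← tsum_geometric_of_norm_lt_one h, ← tsum_mul_left]
  refine tsum_congr fun k => ?_
  rw [kernel_apply, mul_pow]
  ring

theorem inner_kernel_blaschkeMul (x : EllTwo) :
    inner ℂ (kernel r hr0 hr1) (blaschkeMul r hr0 hr1 x) = 0 := by
  have hr : (r : ℂ) ∈ ball (0 : ℂ) 1 := by
    rwa [mem_ball_zero_iff, Complex.norm_real, Real.norm_of_nonneg hr0]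
  rw [inner_kernel, toFun_blaschkeMul hr0 hr1 x hr]
  simp [blaschke]

local notation "Mb" => blaschkeMul r hr0 hr1
local notation "Mbadj" => ContinuousLinearMap.adjoint (blaschkeMul r hr0 hr1)
local notation "κ" => kernel r hr0 hr1

theorem adjoint_blaschkeMul_kernel : Mbadj κ = 0 := by
  refine ext_inner_right ℂ fun x => ?_
  rw [ContinuousLinearMap.adjoint_inner_left, inner_kernel_blaschkeMul, inner_zero_left]

theorem adjoint_blaschkeMul_apply (x : EllTwo) : Mbadj (Mb x) = x := by
  have h := (ContinuousLinearMap.norm_map_iff_adjoint_comp_self _).1 (norm_blaschkeMul hr0 hr1)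
  exact congrArg (fun A : EllTwo →L[ℂ] EllTwo => A x) h

theorem norm_adjoint_blaschkeMul_le (x : EllTwo) : ‖Mbadj x‖ ≤ ‖x‖ := by
  have h : ‖Mbadj‖ ≤ 1 := by
    rw [LinearIsometryEquiv.norm_map]
    exact ContinuousLinearMap.opNorm_le_bound _ zero_le_one fun x => by
      rw [norm_blaschkeMul, one_mul]
  simpa using (Mbadj).le_of_opNorm_le h x

theorem exists_eq_smul_kernel {y : EllTwo} (hy : Mbadj y = 0) : ∃ c : ℂ, y = c • κ := by
  have hs : (Real.sqrt (1 - r ^ 2) : ℂ) ≠ 0 := by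
    have : 0 < Real.sqrt (1 - r ^ 2) := Real.sqrt_pos.2 (by nlinarith)
    exact_mod_cast this.ne'
  have hshift (k : ℕ) : shift (lp.single 2 k (1 : ℂ)) = lp.single 2 (k + 1) (1 : ℂ) := by
    ext j
    cases j <;> simp [Pi.single_apply]
  have hstep (k : ℕ) : y (k + 1) = r * y k := by
    have h : inner ℂ (Mbadj y) (lp.single 2 k (1 : ℂ) - (r : ℂ) • shift (lp.single 2 k (1 : ℂ))) = 0 := by
      rw [hy, inner_zero_left]
    rw [ContinuousLinearMap.adjoint_inner_left, blaschkeMul_sub_smul_shift, hshift, inner_sub_right,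
      inner_smul_right, lp.inner_single_right, lp.inner_single_right] at h
    have h' := congrArg (starRingEnd ℂ) h
    simp at h'
    linear_combination -h'
  have hk (k : ℕ) : y k = y 0 * (r : ℂ) ^ k := by
    induction k with
    | zero => simp
    | succ k ih => rw [hstep, ih, pow_succ]; ring
  refine ⟨y 0 / Real.sqrt (1 - r ^ 2), ?_⟩
  ext k
  rw [lp.coeFn_smul, Pi.smul_apply, smul_eq_mul, kernel_apply, hk]
  field_simp

/-- The Malmquist–Walsh basis, through its Taylor coefficients. -/
def walsh (r : ℝ) (hr0 : 0 ≤ r) (hr1 : r < 1) (k : ℕ) : EllTwo :=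
  (blaschkeMul r hr0 hr1 ^ k) (kernel r hr0 hr1)

local notation "𝐞" => walsh r hr0 hr1

theorem walsh_zero : 𝐞 0 = κ := rfl

theorem blaschkeMul_walsh (k : ℕ) : Mb (𝐞 k) = 𝐞 (k + 1) := by
  rw [walsh, walsh, pow_succ', mul_apply_eq_comp]

theorem adjoint_blaschkeMul_walsh_succ (k : ℕ) : Mbadj (𝐞 (k + 1)) = 𝐞 k := by
  rw [← blaschkeMul_walsh, adjoint_blaschkeMul_apply]

theorem norm_walsh (k : ℕ) : ‖𝐞 k‖ = 1 := by
  induction k with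
  | zero => exact norm_kernel hr0 hr1
  | succ k ih => rw [← blaschkeMul_walsh, norm_blaschkeMul, ih]

theorem inner_walsh_of_lt {i j : ℕ} (h : i < j) : inner ℂ (𝐞 i) (𝐞 j) = 0 := by
  induction i generalizing j with
  | zero =>
    obtain ⟨j, rfl⟩ := Nat.exists_eq_succ_of_ne_zero h.ne'
    rw [← blaschkeMul_walsh, walsh_zero, inner_kernel_blaschkeMul]
  | succ i ih =>
    obtain ⟨j, rfl⟩ := Nat.exists_eq_succ_of_ne_zero (Nat.ne_zero_of_lt h)
    rw [← blaschkeMul_walsh, ← ContinuousLinearMap.adjoint_inner_right,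
      adjoint_blaschkeMul_walsh_succ]
    exact ih (Nat.lt_of_succ_lt_succ h)

theorem orthonormal_walsh : Orthonormal ℂ 𝐞 := by
  refine ⟨norm_walsh hr0 hr1, fun i j hij => ?_⟩
  rcases hij.lt_or_gt with h | h
  · exact inner_walsh_of_lt hr0 hr1 h
  · rw [inner_eq_zero_symm]
    exact inner_walsh_of_lt hr0 hr1 h

theorem toFun_walsh (k : ℕ) {z : ℂ} (hz : z ∈ ball (0 : ℂ) 1) :
    (𝐞 k).toFun z = mw r (k + 1) z := by
  rw [walsh, toFun_blaschkeMul_pow hr0 hr1 k _ hz, toFun_kernel hr0 hr1 hz, mw, Nat.add_sub_cancel,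
    mul_comm]

theorem exists_eq_sum_walsh (n : ℕ) {x : EllTwo} (hx : (Mbadj ^ n) x = 0) :
    ∃ c : ℕ → ℂ, x = ∑ k ∈ range n, c k • 𝐞 k := by
  induction n generalizing x with
  | zero => exact ⟨0, by simpa using hx⟩
  | succ n ih =>
    rw [pow_succ, mul_apply_eq_comp] at hx
    obtain ⟨c, hc⟩ := ih hx
    obtain ⟨a, ha⟩ := exists_eq_smul_kernel hr0 hr1 (y := x - Mb (Mbadj x)) (by
      rw [map_sub, adjoint_blaschkeMul_apply, sub_self])
    refine ⟨fun k => Nat.casesOn k a c, ?_⟩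
    rw [Finset.sum_range_succ', walsh_zero]
    have h : Mb (Mbadj x) = ∑ k ∈ range n, c k • 𝐞 (k + 1) := by
      conv_lhs => rw [hc]
      simp only [map_sum, map_smul, blaschkeMul_walsh]
    change x = ∑ k ∈ range n, c k • 𝐞 (k + 1) + a • κ
    rw [← ha, ← h, add_sub_cancel]

theorem adjoint_pow_walsh {k n : ℕ} (h : k < n) : (Mbadj ^ n) (𝐞 k) = 0 := by
  induction n generalizing k with
  | zero => omega
  | succ n ih =>
    rw [pow_succ, mul_apply_eq_comp]
    cases k with
    | zero => rw [walsh_zero, adjoint_blaschkeMul_kernel, map_zero]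
    | succ k => rw [adjoint_blaschkeMul_walsh_succ, ih (by omega)]

theorem inner_blaschkeMul_pow (n : ℕ) (x y : EllTwo) :
    inner ℂ ((Mb ^ n) x) y = inner ℂ x ((Mbadj ^ n) y) := by
  rw [← ContinuousLinearMap.adjoint_inner_right]
  congr 2
  exact star_pow Mb n

theorem memKB_iff (n : ℕ) (f : ℂ → ℂ) :
    MemKB (fun z => blaschke r z ^ n) f ↔
      MemH2 f ∧ ∃ c : ℕ → ℂ, Set.EqOn f (∑ k ∈ range n, c k • 𝐞 k).toFun (ball 0 1) := by
  constructor
  · rintro ⟨hf, horth⟩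
    refine ⟨hf, ?_⟩
    obtain ⟨x, hx⟩ := hf.exists_eqOn
    have h0 : (Mbadj ^ n) x = 0 := by
      refine ext_inner_left ℂ fun y => ?_
      rw [← inner_blaschkeMul_pow, inner_zero_right,
        ← h2inner_eq_inner hx (fun z hz => (toFun_blaschkeMul_pow hr0 hr1 n y hz).symm)]
      exact horth _ y.memH2_toFun
    obtain ⟨c, hc⟩ := exists_eq_sum_walsh hr0 hr1 n h0
    exact ⟨c, hc ▸ hx⟩
  · rintro ⟨hf, c, hc⟩
    refine ⟨hf, fun g hg => ?_⟩
    obtain ⟨y, hy⟩ := hg.exists_eqOn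
    have h (z) (hz : z ∈ ball (0 : ℂ) 1) : blaschke r z ^ n * g z = ((Mb ^ n) y).toFun z := by
      rw [toFun_blaschkeMul_pow hr0 hr1 n y hz, hy hz]
    rw [h2inner_eq_inner hc h, inner_blaschkeMul_pow, map_sum]
    rw [Finset.sum_eq_zero, inner_zero_right]
    intro k hk
    rw [map_smul, adjoint_pow_walsh hr0 hr1 (Finset.mem_range.1 hk), smul_zero]

/-- The coefficients of the derivative of the `k`-th Malmquist–Walsh function, which involve only
its two neighbours and itself. -/
def walshDeriv (r : ℝ) (hr0 : 0 ≤ r) (hr1 : r < 1) (k : ℕ) : EllTwo :=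
  ((1 - (r : ℂ) ^ 2)⁻¹ : ℂ) • (((r : ℂ) * (2 * k + 1)) • walsh r hr0 hr1 k
    - (k : ℂ) • ContinuousLinearMap.adjoint (blaschkeMul r hr0 hr1) (walsh r hr0 hr1 k)
    - ((r : ℂ) ^ 2 * (k + 1)) • walsh r hr0 hr1 (k + 1))

theorem one_sub_sq_ne_zero (hr0 : 0 ≤ r) (hr1 : r < 1) : (1 - (r : ℂ) ^ 2) ≠ 0 := by
  have : 1 - r ^ 2 ≠ 0 := by nlinarith
  exact_mod_cast this

theorem hasDerivAt_mw (k : ℕ) {z : ℂ} (hz : z ∈ ball (0 : ℂ) 1) :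
    HasDerivAt (mw r (k + 1)) ((walshDeriv r hr0 hr1 k).toFun z) z := by
  have hne := one_sub_mul_ne_zero hr0 hr1 hz
  have hr := one_sub_sq_ne_zero hr0 hr1
  have hden : HasDerivAt (fun z : ℂ => 1 - (r : ℂ) * z) (-r) z := by
    simpa using ((hasDerivAt_id z).const_mul (r : ℂ)).const_sub 1
  have hnum : HasDerivAt (fun z : ℂ => (r : ℂ) - z) (-1) z := (hasDerivAt_id z).const_sub _
  have hb : HasDerivAt (blaschke r) (-(1 - (r : ℂ) ^ 2) / (1 - r * z) ^ 2) z := by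
    have h := hnum.div hden hne
    unfold blaschke
    simp only [Complex.conj_ofReal]
    refine h.congr_deriv ?_
    congr 1
    ring
  have hq := (hasDerivAt_const z (Real.sqrt (1 - r ^ 2) : ℂ)).div hden hne
  have h := hq.mul (hb.pow k)
  refine h.congr_deriv ?_
  rw [walshDeriv, toFun_smul, toFun_sub _ _ hz, toFun_sub _ _ hz, toFun_smul, toFun_smul,
    toFun_smul, toFun_walsh hr0 hr1 _ hz, toFun_walsh hr0 hr1 _ hz]
  have hw : blaschke r z = (r - z) / (1 - r * z) := by simp [blaschke]
  cases k with
  | zero =>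
    simp only [mw, hw, CharP.cast_eq_zero, Pi.pow_apply, Nat.add_sub_cancel, Pi.div_apply, zero_add,
      pow_zero, pow_one]
    field_simp
    ring
  | succ k =>
    rw [adjoint_blaschkeMul_walsh_succ, toFun_walsh hr0 hr1 _ hz]
    simp only [mw, hw, Pi.pow_apply, Nat.add_sub_cancel, pow_succ, Pi.div_apply]
    push_cast
    generalize ((r - z) / (1 - r * z)) ^ k = B
    field_simp
    ring

/-- A finite combination of Malmquist–Walsh functions. -/
def walshSum (r : ℝ) (hr0 : 0 ≤ r) (hr1 : r < 1) (n : ℕ) (c : ℕ → ℂ) : EllTwo :=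
  ∑ k ∈ range n, c k • walsh r hr0 hr1 k

/-- The derivative of a finite combination of Malmquist–Walsh functions. -/
def walshSumDeriv (r : ℝ) (hr0 : 0 ≤ r) (hr1 : r < 1) (n : ℕ) (c : ℕ → ℂ) : EllTwo :=
  ∑ k ∈ range n, c k • walshDeriv r hr0 hr1 k

theorem walshSumDeriv_eq (n : ℕ) (c : ℕ → ℂ) :
    walshSumDeriv r hr0 hr1 n c = ((1 - (r : ℂ) ^ 2)⁻¹ : ℂ) •
      ((r : ℂ) • walshSum r hr0 hr1 n (fun k => (2 * k + 1) * c k)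
        - Mbadj (walshSum r hr0 hr1 n fun k => k * c k)
        - (r : ℂ) ^ 2 • Mb (walshSum r hr0 hr1 n fun k => (k + 1) * c k)) := by
  simp only [walshSumDeriv, walshSum, walshDeriv, map_sum, map_smul, Finset.smul_sum,
    ← Finset.sum_sub_distrib, blaschkeMul_walsh]
  refine Finset.sum_congr rfl fun k _ => ?_
  module

theorem norm_sq_walshSum (n : ℕ) (c : ℕ → ℂ) :
    ‖walshSum r hr0 hr1 n c‖ ^ 2 = ∑ k ∈ range n, ‖c k‖ ^ 2 := by
  have h := (orthonormal_walsh hr0 hr1).inner_sum c c (range n)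
  have h' : ((‖walshSum r hr0 hr1 n c‖ ^ 2 : ℝ) : ℂ) = ((∑ k ∈ range n, ‖c k‖ ^ 2 : ℝ) : ℂ) := by
    rw [walshSum, Complex.ofReal_pow]
    refine (inner_self_eq_norm_sq_to_K (𝕜 := ℂ) _).symm.trans (h.trans ?_)
    push_cast
    exact Finset.sum_congr rfl fun k _ => Complex.conj_mul' (c k)
  exact_mod_cast h'

theorem norm_walshSum_mul_le (n : ℕ) (w c : ℕ → ℂ) {M : ℝ} (hM : 0 ≤ M)
    (hw : ∀ k < n, ‖w k‖ ≤ M) :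
    ‖walshSum r hr0 hr1 n (fun k => w k * c k)‖ ≤ M * ‖walshSum r hr0 hr1 n c‖ := by
  rw [← sq_le_sq₀ (norm_nonneg _) (by positivity), mul_pow, norm_sq_walshSum, norm_sq_walshSum,
    Finset.mul_sum]
  refine Finset.sum_le_sum fun k hk => ?_
  rw [norm_mul, mul_pow]
  gcongr
  exact hw k (Finset.mem_range.1 hk)

theorem norm_walshSumDeriv_le (n : ℕ) (c : ℕ → ℂ) :
    ‖walshSumDeriv r hr0 hr1 n c‖ ≤ 4 / (1 - r ^ 2) * n * ‖walshSum r hr0 hr1 n c‖ := by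
  have h2 : 0 < 1 - r ^ 2 := by nlinarith
  set N := ‖walshSum r hr0 hr1 n c‖
  have h1 : ‖walshSum r hr0 hr1 n fun k => (2 * k + 1) * c k‖ ≤ 2 * n * N :=
    norm_walshSum_mul_le hr0 hr1 n _ c (by positivity) fun k hk => by
      have : ((2 * k + 1 : ℕ) : ℝ) ≤ (2 * n : ℕ) := by exact_mod_cast (by omega)
      rw [← Nat.cast_two, ← Nat.cast_mul, ← Nat.cast_succ, Complex.norm_natCast]
      exact_mod_cast this
  have h3 : ‖walshSum r hr0 hr1 n fun k => k * c k‖ ≤ n * N :=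
    norm_walshSum_mul_le hr0 hr1 n _ c (by positivity) fun k hk => by
      rw [Complex.norm_natCast]
      exact_mod_cast hk.le
  have h4 : ‖walshSum r hr0 hr1 n fun k => (k + 1) * c k‖ ≤ n * N :=
    norm_walshSum_mul_le hr0 hr1 n _ c (by positivity) fun k hk => by
      rw [← Nat.cast_succ, Complex.norm_natCast]
      exact_mod_cast hk
  have h5 : ‖((1 - (r : ℂ) ^ 2)⁻¹ : ℂ)‖ = (1 - r ^ 2)⁻¹ := by
    rw [← Complex.ofReal_pow, ← Complex.ofReal_one, ← Complex.ofReal_sub, ← Complex.ofReal_inv,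
      Complex.norm_real, Real.norm_of_nonneg (by positivity)]
  have hnN : 0 ≤ n * N := by positivity
  have h6 : ‖(r : ℂ) • walshSum r hr0 hr1 n fun k => (2 * k + 1) * c k‖ ≤ 2 * n * N := by
    rw [norm_smul, Complex.norm_real, Real.norm_of_nonneg hr0]
    exact (mul_le_of_le_one_left (norm_nonneg _) hr1.le).trans h1
  have h7 : ‖Mbadj (walshSum r hr0 hr1 n fun k => k * c k)‖ ≤ n * N :=
    (norm_adjoint_blaschkeMul_le hr0 hr1 _).trans h3
  have h8 : ‖(r : ℂ) ^ 2 • Mb (walshSum r hr0 hr1 n fun k => (k + 1) * c k)‖ ≤ n * N := by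
    rw [norm_smul, norm_blaschkeMul, norm_pow, Complex.norm_real, Real.norm_of_nonneg hr0]
    exact (mul_le_of_le_one_left (norm_nonneg _) (by linarith)).trans h4
  rw [walshSumDeriv_eq, norm_smul, h5]
  calc _ ≤ (1 - r ^ 2)⁻¹ * (2 * n * N + n * N + n * N) := by
        gcongr
        exact (norm_sub_le _ _).trans (add_le_add ((norm_sub_le _ _).trans (add_le_add h6 h7)) h8)
    _ = _ := by ring

theorem inner_walsh_walshSumDeriv {n j : ℕ} (hj : j + 2 < n) (c : ℕ → ℂ) :
    inner ℂ (𝐞 (j + 1)) (walshSumDeriv r hr0 hr1 n c) = ((1 - (r : ℂ) ^ 2)⁻¹ : ℂ) *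
      (r * ((2 * j + 3) * c (j + 1)) - (j + 2) * c (j + 2) - r ^ 2 * ((j + 1) * c j)) := by
  have hsum (l : ℕ → ℂ) {i : ℕ} (hi : i < n) : inner ℂ (𝐞 i) (walshSum r hr0 hr1 n l) = l i :=
    (orthonormal_walsh hr0 hr1).inner_right_sum l (Finset.mem_range.2 hi)
  rw [walshSumDeriv_eq, inner_smul_right, inner_sub_right, inner_sub_right, inner_smul_right,
    inner_smul_right, ContinuousLinearMap.adjoint_inner_right, blaschkeMul_walsh,
    ← blaschkeMul_walsh _ _ j, ← ContinuousLinearMap.adjoint_inner_left,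
    adjoint_blaschkeMul_apply, blaschkeMul_walsh, hsum _ (by omega), hsum _ hj,
    hsum _ (by omega)]
  push_cast
  ring

theorem hasDerivAt_of_eqOn_walshSum {f : ℂ → ℂ} {n : ℕ} {c : ℕ → ℂ}
    (hf : Set.EqOn f (walshSum r hr0 hr1 n c).toFun (ball 0 1)) {z : ℂ}
    (hz : z ∈ ball (0 : ℂ) 1) : HasDerivAt f ((walshSumDeriv r hr0 hr1 n c).toFun z) z := by
  have h : HasDerivAt (fun z => ∑ k ∈ range n, c k * mw r (k + 1) z)
      ((walshSumDeriv r hr0 hr1 n c).toFun z) z := by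
    rw [walshSumDeriv, toFun_sum _ _ _ hz]
    exact HasDerivAt.fun_sum fun k _ => (hasDerivAt_mw hr0 hr1 k hz).const_mul (c k)
  refine h.congr_of_eventuallyEq ?_
  filter_upwards [isOpen_ball.mem_nhds hz] with w hw
  rw [hf hw, walshSum, toFun_sum _ _ _ hw]
  exact Finset.sum_congr rfl fun k _ => by rw [toFun_walsh hr0 hr1 k hw]

theorem DNorm_set_eq (n : ℕ) :
    {x : ℝ | ∃ f : ℂ → ℂ, MemKB (fun z => blaschke r z ^ n) f ∧ h2norm f ≤ 1 ∧
      x = h2norm (deriv f)} =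
    {x : ℝ | ∃ c : ℕ → ℂ, ‖walshSum r hr0 hr1 n c‖ ≤ 1 ∧ x = ‖walshSumDeriv r hr0 hr1 n c‖} := by
  ext x
  constructor
  · rintro ⟨f, hf, hf1, rfl⟩
    obtain ⟨-, c, hc⟩ := (memKB_iff hr0 hr1 n f).1 hf
    exact ⟨c, (h2norm_eq_norm hc).symm.trans_le hf1,
      h2norm_deriv_eq_norm fun z hz => hasDerivAt_of_eqOn_walshSum hr0 hr1 hc hz⟩
  · rintro ⟨c, hc, rfl⟩
    have hrefl := Set.eqOn_refl (walshSum r hr0 hr1 n c).toFun (ball 0 1)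
    exact ⟨_, (memKB_iff hr0 hr1 n _).2 ⟨memH2_toFun _, c, hrefl⟩, (h2norm_eq_norm hrefl).trans_le hc,
      (h2norm_deriv_eq_norm fun z hz => hasDerivAt_of_eqOn_walshSum hr0 hr1 hrefl hz).symm⟩

theorem walshSumDeriv_bound_of_le_one {n : ℕ} {c : ℕ → ℂ} (hc : ‖walshSum r hr0 hr1 n c‖ ≤ 1) :
    ‖walshSumDeriv r hr0 hr1 n c‖ ≤ 4 / (1 - r ^ 2) * n := by
  have h2 : 0 < 1 - r ^ 2 := by nlinarith
  exact (norm_walshSumDeriv_le hr0 hr1 n c).trans (mul_le_of_le_one_right (by positivity) hc)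

theorem DNorm_blaschke_pow_le (hr0 : 0 ≤ r) (hr1 : r < 1) (n : ℕ) :
    DNorm (fun z => blaschke r z ^ n) ≤ 4 / (1 - r ^ 2) * n := by
  have h2 : 0 < 1 - r ^ 2 := by nlinarith
  rw [DNorm, DNorm_set_eq hr0 hr1]
  refine Real.sSup_le ?_ (by positivity)
  rintro x ⟨c, hc, rfl⟩
  exact walshSumDeriv_bound_of_le_one hr0 hr1 hc

theorem norm_walshSumDeriv_le_DNorm {n : ℕ} {c : ℕ → ℂ} (hc : ‖walshSum r hr0 hr1 n c‖ ≤ 1) :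
    ‖walshSumDeriv r hr0 hr1 n c‖ ≤ DNorm (fun z => blaschke r z ^ n) := by
  rw [DNorm, DNorm_set_eq hr0 hr1]
  refine le_csSup ⟨4 / (1 - r ^ 2) * n, ?_⟩ ⟨c, hc, rfl⟩
  rintro x ⟨c, hc, rfl⟩
  exact walshSumDeriv_bound_of_le_one hr0 hr1 hc

theorem le_DNorm_blaschke_pow (hr0 : 0 ≤ r) (hr1 : r < 1) (a p : ℕ) :
    (1 + r) / (1 - r) * a * Real.sqrt (p / (p + 2)) ≤
      DNorm (fun z => blaschke r z ^ (a + (p + 2))) := by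
  have h2 : 0 < 1 - r ^ 2 := by nlinarith
  set s : ℝ := (Real.sqrt (p + 2))⁻¹ with hs
  have hs0 : 0 ≤ s := by positivity
  have hss : s ^ 2 = ((p : ℝ) + 2)⁻¹ := by rw [hs, inv_pow, Real.sq_sqrt (by positivity)]
  set c : ℕ → ℂ := fun k => if a ≤ k then s * (-1) ^ k else 0 with hc
  have hca (k : ℕ) (hk : a ≤ k) : c k = s * (-1) ^ k := if_pos hk
  have hnorm : ‖walshSum r hr0 hr1 (a + (p + 2)) c‖ ≤ 1 := by
    rw [← sq_le_sq₀ (norm_nonneg _) zero_le_one, norm_sq_walshSum, Finset.sum_range_add,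
      Finset.sum_eq_zero, zero_add, Finset.sum_congr rfl (g := fun _ => s ^ 2)]
    · rw [Finset.sum_const, Finset.card_range, hss, nsmul_eq_mul]
      push_cast
      rw [mul_inv_cancel₀ (by positivity), one_pow]
    · intro k _
      rw [hca _ (Nat.le_add_right a k)]
      simp
    · intro k hk
      have : ¬ a ≤ k := by simpa using hk
      simp [hc, this]
  refine le_trans ?_ (norm_walshSumDeriv_le_DNorm hr0 hr1 hnorm)
  have hK : (1 + r) / (1 - r) = (1 + r) ^ 2 / (1 - r ^ 2) := by
    have : 1 - r ≠ 0 := by linarith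
    field_simp
    ring
  have hK0 : 0 ≤ (1 + r) / (1 - r) := by rw [hK]; positivity
  have hinner (i : ℕ) (hi : i < p) : (1 + r) / (1 - r) * a * s ≤
      ‖inner ℂ (walsh r hr0 hr1 (a + i + 1)) (walshSumDeriv r hr0 hr1 (a + (p + 2)) c)‖ := by
    rw [inner_walsh_walshSumDeriv hr0 hr1 (by omega), hca _ (by omega), hca _ (by omega),
      hca _ (by omega)]
    have h : ((1 - (r : ℂ) ^ 2)⁻¹ : ℂ) *
        (r * ((2 * (a + i : ℕ) + 3) * (s * (-1) ^ (a + i + 1)))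
          - ((a + i : ℕ) + 2) * (s * (-1) ^ (a + i + 2))
          - r ^ 2 * (((a + i : ℕ) + 1) * (s * (-1) ^ (a + i)))) =
        (((1 - r ^ 2)⁻¹ * (s * (r * (2 * (a + i) + 3) + (a + i + 2) + r ^ 2 * (a + i + 1))) : ℝ) : ℂ)
          * (-1) ^ (a + i + 1) := by
      push_cast
      ring
    rw [h, norm_mul, norm_pow, norm_neg, norm_one, one_pow, mul_one, Complex.norm_real,
      Real.norm_of_nonneg (by positivity), hK, div_eq_mul_inv, mul_comm (_ ^ 2), mul_assoc,
      mul_assoc, mul_comm _ s, mul_left_comm _ s]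
    gcongr
    have hi0 : (0 : ℝ) ≤ i := by positivity
    nlinarith [mul_nonneg hr0 hi0, mul_nonneg (sq_nonneg r) hi0, sq_nonneg r]
  have hinj : Function.Injective fun i => a + i + 1 := fun i j h => by simpa using h
  have hbessel := ((orthonormal_walsh hr0 hr1).comp _ hinj).sum_inner_products_le
    (walshSumDeriv r hr0 hr1 (a + (p + 2)) c) (s := range p)
  rw [← sq_le_sq₀ (by positivity) (norm_nonneg _)]
  refine le_trans ?_ hbessel
  have hle : ∑ _i ∈ range p, ((1 + r) / (1 - r) * a * s) ^ 2 ≤ _ :=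
    Finset.sum_le_sum fun i hi =>
      pow_le_pow_left₀ (by positivity) (hinner i (Finset.mem_range.1 hi)) 2
  refine le_trans (le_of_eq ?_) hle
  rw [Finset.sum_const, Finset.card_range, nsmul_eq_mul, mul_pow _ s, hss, mul_pow _ (√_),
    Real.sq_sqrt (by positivity)]
  ring

end

end EllTwo

theorem tendsto_sqrt_div_add_two :
    Tendsto (fun p : ℕ => Real.sqrt ((p : ℝ) / (p + 2))) atTop (nhds 1) := by
  simpa using (tendsto_natCast_div_add_atTop (2 : ℝ)).sqrt

theorem mul_sqrt_le_liminf_DNorm {r : ℝ} (hr0 : 0 ≤ r) (hr1 : r < 1) (p : ℕ) :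
    (1 + r) / (1 - r) * Real.sqrt (p / (p + 2)) ≤
      liminf (fun n : ℕ => DNorm (fun z => (blaschke (r : ℂ) z) ^ n) / n) atTop := by
  have h2 : 0 < 1 - r ^ 2 := by nlinarith
  have hlim : Tendsto (fun n : ℕ => (1 + r) / (1 - r) * Real.sqrt (p / (p + 2)) *
      (1 - (p + 2) / (n : ℝ))) atTop (nhds ((1 + r) / (1 - r) * Real.sqrt (p / (p + 2)))) := by
    have h := ((tendsto_const_div_atTop_nhds_zero_nat ((p : ℝ) + 2)).const_sub 1).const_mul
      ((1 + r) / (1 - r) * Real.sqrt (p / (p + 2)))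
    simpa using h
  rw [← hlim.liminf_eq]
  refine liminf_le_liminf ?_ hlim.isBoundedUnder_ge ?_
  · filter_upwards [eventually_ge_atTop (p + 2)] with n hn
    obtain ⟨a, rfl⟩ := Nat.exists_eq_add_of_le' hn
    have hn0 : (0 : ℝ) < ((a + (p + 2) : ℕ) : ℝ) := by positivity
    rw [le_div_iff₀ hn0]
    refine le_trans (le_of_eq ?_) (EllTwo.le_DNorm_blaschke_pow hr0 hr1 a p)
    rw [mul_assoc, sub_mul, one_mul, div_mul_cancel₀ _ hn0.ne']
    push_cast
    ring
  · refine IsBoundedUnder.isCoboundedUnder_ge (isBoundedUnder_of ⟨4 / (1 - r ^ 2), fun n => ?_⟩)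
    exact div_le_of_le_mul₀ (by positivity) (by positivity)
      (EllTwo.DNorm_blaschke_pow_le hr0 hr1 n)

/-- For every `r ∈ [0,1)`,
`liminf_{n→∞} (1/n)·‖D‖_{K_{b_r^n}→H²} ≥ (1+r)/(1-r)`. -/
theorem stmt5 (r : ℝ) (hr0 : 0 ≤ r) (hr1 : r < 1) :
    (1 + r) / (1 - r) ≤
      liminf (fun n : ℕ => DNorm (fun z => (blaschke (r : ℂ) z) ^ n) / n) atTop := by
  have h := tendsto_sqrt_div_add_two.const_mul ((1 + r) / (1 - r))
  rw [mul_one] at h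
  exact le_of_tendsto' h (mul_sqrt_le_liminf_DNorm hr0 hr1)
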